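/- Let n ≥ 2. For every natural number s, the s-th term of the upper central series of the Lie algebra u_n equals ⊕_{i=0}^{s-1} K x_1^i ∂_n; here the upper central series is defined by Z_0 = 0 and Z_{s+1} = the preimage in u_n of the centre of u_n/Z_s, so Z_1 is the centre of u_n. -/

import Mathlib

open MvPolynomial

noncomputable section


/-- If a derivation of `MvPolynomial σ K` maps every generator `X j`, `j ∈ s`, into the
subalgebra `supported K s` of polynomials supported on `s`, then it maps the whole of
`supported K s` into itself. -/
theorem Derivation.mem_supported_of_forall_mem
    {K : Type*} [CommRing K] {σ : Type*} (s : Set σ)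
    (D : Derivation K (MvPolynomial σ K) (MvPolynomial σ K))
    (h : ∀ j ∈ s, D (X j) ∈ supported K s)
    {p : MvPolynomial σ K} (hp : p ∈ supported K s) : D p ∈ supported K s := by
  rw [supported_eq_adjoin_X] at hp
  induction hp using Algebra.adjoin_induction with
  | mem x hx =>
    obtain ⟨j, hj, rfl⟩ := hx
    exact h j hj
  | algebraMap r =>
    rw [Derivation.map_algebraMap]
    exact zero_mem _
  | add x y hx hy ihx ihy =>
    rw [map_add]
    exact add_mem ihx ihy
  | mul x y hx hy ihx ihy =>
    rw [Derivation.leibniz, smul_eq_mul, smul_eq_mul]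
    rw [← supported_eq_adjoin_X] at hx hy
    exact add_mem (mul_mem hx ihy) (mul_mem hy ihx)

/-- If a derivation of `MvPolynomial σ K` kills every generator `X j`, `j ∈ s`, then it
kills the whole subalgebra `supported K s`. -/
theorem Derivation.eq_zero_of_forall_eq_zero
    {K : Type*} [CommRing K] {σ : Type*} (s : Set σ)
    (D : Derivation K (MvPolynomial σ K) (MvPolynomial σ K))
    (h : ∀ j ∈ s, D (X j) = 0)
    {p : MvPolynomial σ K} (hp : p ∈ supported K s) : D p = 0 := by
  rw [supported_eq_adjoin_X] at hp
  induction hp using Algebra.adjoin_induction with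
  | mem x hx =>
    obtain ⟨j, hj, rfl⟩ := hx
    exact h j hj
  | algebraMap r =>
    rw [Derivation.map_algebraMap]
  | add x y hx hy ihx ihy =>
    rw [map_add, ihx, ihy, add_zero]
  | mul x y hx hy ihx ihy =>
    rw [Derivation.leibniz, ihx, ihy, smul_zero, smul_zero, add_zero]

/-- The defining condition for the Lie algebra `u_n = K∂₁ ⊕ P₁∂₂ ⊕ ⋯ ⊕ P_{n-1}∂ₙ` of
triangular polynomial derivations of `P_n = K[x₁,…,xₙ]` (variables indexed by `Fin n`,
zero-based): a derivation `D` of `P_n` is triangular iff, for every `i`, the polynomial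
`D (X i)` only involves the variables `X j` with `j < i` (so the coefficient of `∂_i`
lies in `P_{i-1}`, where `P₀ = K`). -/
def triSet (K : Type*) [Field K] (n : ℕ) :
    Set (Derivation K (MvPolynomial (Fin n) K) (MvPolynomial (Fin n) K)) :=
  {D | ∀ i : Fin n, D (X i) ∈ supported K {j : Fin n | (j : ℕ) < (i : ℕ)}}

theorem supported_upward {K : Type*} [Field K] {n : ℕ}
    (p : MvPolynomial (Fin n) K) (s t : Set (Fin n)) (hst : s ⊆ t)
    (hp : p ∈ supported K s) : p ∈ supported K t :=
  supported_mono hst hp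

theorem triSet_stable {K : Type*} [Field K] {n : ℕ}
    {D : Derivation K (MvPolynomial (Fin n) K) (MvPolynomial (Fin n) K)}
    (hD : D ∈ triSet K n) (i : Fin n) :
    ∀ j ∈ {j' : Fin n | (j' : ℕ) < (i : ℕ)},
      D (X j) ∈ supported K {j' : Fin n | (j' : ℕ) < (i : ℕ)} := by
  intro j hj
  refine supported_upward _ {j' : Fin n | (j' : ℕ) < (j : ℕ)} _ ?_ (hD j)
  intro l hl
  have hl' : (l : ℕ) < (j : ℕ) := hl
  have hj' : (j : ℕ) < (i : ℕ) := hj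
  exact lt_trans hl' hj'

theorem triSet_lie {K : Type*} [Field K] {n : ℕ}
    {a b : Derivation K (MvPolynomial (Fin n) K) (MvPolynomial (Fin n) K)}
    (ha : a ∈ triSet K n) (hb : b ∈ triSet K n) : ⁅a, b⁆ ∈ triSet K n := by
  intro i
  rw [Derivation.commutator_apply]
  exact sub_mem
    (Derivation.mem_supported_of_forall_mem _ a (triSet_stable ha i) (hb i))
    (Derivation.mem_supported_of_forall_mem _ b (triSet_stable hb i) (ha i))

/-- The Lie algebra `u_n = K∂₁ ⊕ P₁∂₂ ⊕ ⋯ ⊕ P_{n-1}∂ₙ` of triangular polynomial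
derivations, as a Lie subalgebra of the Lie algebra of all `K`-derivations of the
polynomial algebra `P_n = K[x₁,…,xₙ]`. -/
def triangular (K : Type*) [Field K] (n : ℕ) :
    LieSubalgebra K (Derivation K (MvPolynomial (Fin n) K) (MvPolynomial (Fin n) K)) where
  carrier := triSet K n
  add_mem' := fun {a b} ha hb i => by
    rw [Derivation.add_apply]; exact add_mem (ha i) (hb i)
  zero_mem' := fun i => by
    rw [Derivation.zero_apply]; exact zero_mem _
  smul_mem' := fun c a ha i => by
    rw [Derivation.smul_apply]; exact Subalgebra.smul_mem _ (ha i) c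
  lie_mem' := fun {a b} ha hb => triSet_lie ha hb

theorem mem_triangular_iff {K : Type*} [Field K] {n : ℕ}
    (D : Derivation K (MvPolynomial (Fin n) K) (MvPolynomial (Fin n) K)) :
    D ∈ triangular K n ↔
      ∀ i : Fin n, D (X i) ∈ supported K {j : Fin n | (j : ℕ) < (i : ℕ)} := Iff.rfl

/-- The partial derivative `∂ᵢ` as an element of the Lie algebra `u_n`. -/
def pd (K : Type*) [Field K] (n : ℕ) (i : Fin n) : ↥(triangular K n) :=
  ⟨pderiv i, by
    intro j
    rcases eq_or_ne j i with rfl | h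
    · rw [pderiv_X_self]
      exact one_mem _
    · rw [pderiv_X_of_ne h]
      exact zero_mem _⟩

/-- The element `x₁^i ∂ₙ` of the Lie algebra `u_n` (`x₁ = X ⟨0,_⟩`, `∂ₙ = pderiv ⟨n-1,_⟩`). -/
def mon (K : Type*) [Field K] (n : ℕ) (hn : 2 ≤ n) (i : ℕ) : ↥(triangular K n) :=
  ⟨(X (⟨0, by omega⟩ : Fin n)) ^ i • pderiv (⟨n - 1, by omega⟩ : Fin n), by
    intro j
    rw [Derivation.smul_apply, smul_eq_mul]
    rcases eq_or_ne j (⟨n - 1, by omega⟩ : Fin n) with rfl | h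
    · rw [pderiv_X_self, mul_one]
      refine pow_mem (X_mem_supported.mpr ?_) i
      show (0 : ℕ) < n - 1
      omega
    · rw [pderiv_X_of_ne h, mul_zero]
      exact zero_mem _⟩

/-- Polynomials all of whose monomials are `X z ^ i` with `i < s`. -/
def WW (K : Type*) [Field K] {n : ℕ} (z : Fin n) (s : ℕ) :
    Submodule K (MvPolynomial (Fin n) K) where
  carrier := {f | ∀ m, coeff m f ≠ 0 → ∃ i < s, m = Finsupp.single z i}
  add_mem' := by
    intro a b ha hb m hm
    by_cases h : coeff m a = 0
    · apply hb
      intro h'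
      exact hm (by rw [coeff_add, h, h', add_zero])
    · exact ha m h
  zero_mem' := by
    intro m hm
    simp at hm
  smul_mem' := by
    intro c a ha m hm
    apply ha
    intro h
    exact hm (by rw [coeff_smul, h, smul_zero])

theorem mem_WW {K : Type*} [Field K] {n : ℕ} {z : Fin n} {s : ℕ} {f : MvPolynomial (Fin n) K} :
    f ∈ WW K z s ↔ ∀ m, coeff m f ≠ 0 → ∃ i < s, m = Finsupp.single z i := Iff.rfl

theorem X_pow_mem_WW {K : Type*} [Field K] {n : ℕ} {z : Fin n} {s i : ℕ} (hi : i < s) :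
    (X z : MvPolynomial (Fin n) K) ^ i ∈ WW K z s := by
  intro m hm
  rw [coeff_X_pow] at hm
  refine ⟨i, hi, ?_⟩
  by_contra h
  exact hm (if_neg (fun h' => h h'.symm))

theorem WW_degree {K : Type*} [Field K] {n : ℕ} {z j : Fin n} {s : ℕ}
    {g : MvPolynomial (Fin n) K} (h : X j ^ s * g ∈ WW K z s) : g = 0 := by
  ext m
  rw [coeff_zero]
  by_contra hm
  obtain ⟨i, hi, e⟩ := h (Finsupp.single j s + m) (by
    rw [X_pow_eq_monomial, coeff_monomial_mul, one_mul]; exact hm)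
  have h1 := DFunLike.congr_fun e j
  rw [Finsupp.add_apply, Finsupp.single_eq_same] at h1
  have h2 : (Finsupp.single z i : Fin n →₀ ℕ) j ≤ i := by
    rw [Finsupp.single_apply]; split_ifs <;> omega
  omega

theorem WW_integrate {K : Type*} [Field K] [CharZero K] {n : ℕ} {z : Fin n} {s : ℕ}
    {f : MvPolynomial (Fin n) K} (h0 : pderiv z f ∈ WW K z s)
    (h : ∀ j, j ≠ z → pderiv j f = 0) : f ∈ WW K z (s + 1) := by
  intro m hm
  have key : ∀ j, m j ≠ 0 → coeff (m - Finsupp.single j 1) (pderiv j f) ≠ 0 := by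
    intro j hj
    rw [coeff_pderiv, tsub_add_cancel_of_le (by
      rw [Finsupp.single_le_iff]; omega)]
    exact mul_ne_zero hm (Nat.cast_add_one_ne_zero _)
  have hz : ∀ j, j ≠ z → m j = 0 := by
    intro j hj
    by_contra hmj
    exact key j hmj (by rw [h j hj, coeff_zero])
  have hms : m = Finsupp.single z (m z) := by
    ext j
    by_cases hj : j = z
    · subst hj; simp
    · rw [hz j hj, Finsupp.single_eq_of_ne hj]
  refine ⟨m z, ?_, hms⟩
  by_cases hmz : m z = 0
  · omega
  · obtain ⟨i, hi, e⟩ := h0 _ (key z hmz)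
    have := DFunLike.congr_fun e z
    simp at this
    omega

theorem WW_eq_sum {K : Type*} [Field K] {n : ℕ} {z : Fin n} {s : ℕ}
    {f : MvPolynomial (Fin n) K} (h : f ∈ WW K z s) :
    f = ∑ i ∈ Finset.range s, coeff (Finsupp.single z i) f • (X z : MvPolynomial (Fin n) K) ^ i := by
  classical
  ext m
  rw [coeff_sum]
  simp only [coeff_smul, coeff_X_pow, smul_eq_mul, mul_ite, mul_one, mul_zero]
  by_cases hm : coeff m f = 0
  · rw [hm]
    symm
    apply Finset.sum_eq_zero
    intro i _
    split_ifs with e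
    · rw [e, hm]
    · rfl
  · obtain ⟨i, hi, rfl⟩ := h m hm
    rw [Finset.sum_eq_single i]
    · simp
    · intro j _ hj
      rw [if_neg]
      intro e
      exact hj (Finsupp.single_injective z e)
    · intro h'
      exact absurd (Finset.mem_range.mpr hi) h'

theorem mem_span_mon {K : Type*} [Field K] {n : ℕ} (hn : 2 ≤ n) (s : ℕ) (D : ↥(triangular K n)) :
    D ∈ Submodule.span K (mon K n hn '' Set.Iio s) ↔
      (∀ j : Fin n, j ≠ ⟨n - 1, by omega⟩ → D.1 (X j) = 0) ∧
        D.1 (X ⟨n - 1, by omega⟩) ∈ WW K (⟨0, by omega⟩ : Fin n) s := by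
  constructor
  · intro hD
    induction hD using Submodule.span_induction with
    | mem x hx =>
      obtain ⟨i, hi, rfl⟩ := hx
      constructor
      · intro j hj
        simp only [mon, Derivation.smul_apply]
        rw [pderiv_X_of_ne hj, smul_zero]
      · simp only [mon, Derivation.smul_apply]
        rw [pderiv_X_self, smul_eq_mul, mul_one]
        exact X_pow_mem_WW hi
    | zero => exact ⟨fun j _ => rfl, zero_mem _⟩
    | add x y _ _ hx hy =>
      refine ⟨fun j hj => ?_, add_mem hx.2 hy.2⟩
      change x.1 (X j) + y.1 (X j) = 0
      rw [hx.1 j hj, hy.1 j hj, add_zero]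
    | smul c x _ hx =>
      refine ⟨fun j hj => ?_, Submodule.smul_mem _ c hx.2⟩
      change c • x.1 (X j) = 0
      rw [hx.1 j hj, smul_zero]
  · rintro ⟨h1, h2⟩
    have hs := WW_eq_sum h2
    have : D = ∑ i ∈ Finset.range s, coeff (Finsupp.single (⟨0, by omega⟩ : Fin n) i)
        (D.1 (X ⟨n - 1, by omega⟩)) • mon K n hn i := by
      apply Subtype.ext
      apply derivation_ext
      intro j
      have hc : ∀ c : ℕ → K, (∑ i ∈ Finset.range s, c i • mon K n hn i : ↥(triangular K n)).1 (X j)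
          = ∑ i ∈ Finset.range s, c i • ((mon K n hn i).1 (X j)) := by
        intro c
        induction s with
        | zero => rfl
        | succ k _ =>
          clear * -
          generalize k + 1 = t
          induction t with
          | zero => rfl
          | succ t ih =>
            rw [Finset.sum_range_succ, Finset.sum_range_succ, ← ih]
            rfl
      rw [hc]
      by_cases hj : j = ⟨n - 1, by omega⟩
      · subst hj
        simp only [mon, Derivation.smul_apply, pderiv_X_self, smul_eq_mul, mul_one]
        exact hs
      · rw [h1 j hj]
        symm
        apply Finset.sum_eq_zero
        intro i _
        simp only [mon, Derivation.smul_apply]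
        rw [pderiv_X_of_ne hj, smul_zero, smul_zero]
    rw [this]
    refine Submodule.sum_mem _ fun i hi => Submodule.smul_mem _ _ (Submodule.subset_span ?_)
    exact ⟨i, Finset.mem_range.mp hi, rfl⟩

/-- The element `x_j^m ∂_k`, `j < k`. -/
def el (K : Type*) [Field K] {n : ℕ} (j k : Fin n) (h : j < k) (m : ℕ) : ↥(triangular K n) :=
  ⟨X j ^ m • pderiv k, by
    intro i
    rw [Derivation.smul_apply, smul_eq_mul]
    rcases eq_or_ne i k with rfl | h'
    · rw [pderiv_X_self, mul_one]
      refine pow_mem (X_mem_supported.mpr ?_) m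
      exact h
    · rw [pderiv_X_of_ne h', mul_zero]
      exact zero_mem _⟩

theorem lie_val {K : Type*} [Field K] {n : ℕ} (E D : ↥(triangular K n))
    (p : MvPolynomial (Fin n) K) : (⁅E, D⁆ : ↥(triangular K n)).1 p = E.1 (D.1 p) - D.1 (E.1 p) := by
  rw [LieSubalgebra.coe_bracket, Derivation.commutator_apply]

theorem pderiv_last {K : Type*} [Field K] {n : ℕ} (E : ↥(triangular K n)) (k j : Fin n)
    (h : j ≤ k) : pderiv k (E.1 (X j)) = 0 := by
  refine Derivation.eq_zero_of_forall_eq_zero _ (pderiv k) ?_ (E.2 j)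
  intro i hi
  apply pderiv_X_of_ne
  have hi' : (i : ℕ) < j := hi
  intro e
  subst e
  exact absurd (Fin.le_def.mp h) (by omega)

theorem step_mem {K : Type*} [Field K] [CharZero K] {n : ℕ} (hn : 2 ≤ n) (s : ℕ)
    (D : ↥(triangular K n)) :
    D ∈ Submodule.span K (mon K n hn '' Set.Iio (s + 1)) ↔
      ∀ E : ↥(triangular K n), ⁅E, D⁆ ∈ Submodule.span K (mon K n hn '' Set.Iio s) := by
  have hle : ∀ j : Fin n, j ≤ ⟨n - 1, by omega⟩ := fun j => by
    rw [Fin.le_def]; show (j : ℕ) ≤ n - 1; omega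
  constructor
  · intro hD E
    induction hD using Submodule.span_induction with
    | mem x hx =>
      obtain ⟨i, hi, rfl⟩ := hx
      rw [mem_span_mon]
      have hk : ∀ j, (mon K n hn i).1 (E.1 (X j)) = 0 := by
        intro j
        simp only [mon, Derivation.smul_apply]
        rw [pderiv_last E _ j (hle j), smul_zero]
      constructor
      · intro j hj
        rw [lie_val, hk, sub_zero]
        simp only [mon, Derivation.smul_apply]
        rw [pderiv_X_of_ne hj, smul_zero, map_zero]
      · rw [lie_val, hk, sub_zero]
        simp only [mon, Derivation.smul_apply]
        rw [pderiv_X_self, smul_eq_mul, mul_one, Derivation.leibniz_pow]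
        have h0 := E.2 (⟨0, by omega⟩ : Fin n)
        have he : {j : Fin n | (j : ℕ) < ((⟨0, by omega⟩ : Fin n) : ℕ)} = ∅ := by
          ext j; simp
        rw [he, supported_empty, Algebra.mem_bot] at h0
        obtain ⟨c, hc⟩ := h0
        rw [← hc]
        rcases Nat.eq_zero_or_pos i with rfl | hpos
        · rw [zero_smul]; exact zero_mem _
        · have hi' : i < s + 1 := hi
          rw [smul_eq_mul, mul_comm, ← Algebra.smul_def]
          exact nsmul_mem (Submodule.smul_mem _ _ (X_pow_mem_WW (by omega))) _
    | zero => rw [lie_zero]; exact zero_mem _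
    | add x y _ _ hx hy => rw [lie_add]; exact add_mem hx hy
    | smul c x _ hx => rw [lie_smul]; exact Submodule.smul_mem _ c hx
  · intro h
    have h' := fun E => (mem_span_mon hn s _).mp (h E)
    rw [mem_span_mon]
    have hzero : ∀ j : Fin n, j ≠ ⟨n - 1, by omega⟩ → D.1 (X j) = 0 := by
      intro j hj
      have := (h' (el K j _ (lt_of_le_of_ne (hle j) hj) (s + 1))).2
      rw [lie_val] at this
      simp only [el, Derivation.smul_apply] at this
      rw [pderiv_X_self, pderiv_last D _ _ le_rfl, smul_zero, zero_sub, smul_eq_mul, mul_one,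
        Derivation.leibniz_pow, neg_mem_iff, Nat.add_sub_cancel, ← Nat.cast_smul_eq_nsmul K,
        Submodule.smul_mem_iff _ (by exact_mod_cast Nat.succ_ne_zero s)] at this
      exact WW_degree this
    refine ⟨hzero, WW_integrate ?_ ?_⟩
    · have := (h' (pd K n ⟨0, by omega⟩)).2
      rw [lie_val] at this
      simp only [pd] at this
      rwa [pderiv_X_of_ne (by rw [Ne, Fin.mk.injEq]; omega), map_zero, sub_zero] at this
    · intro j hj
      by_cases hjl : j = ⟨n - 1, by omega⟩
      · subst hjl
        exact pderiv_last D _ _ le_rfl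
      · have hlt : (⟨0, by omega⟩ : Fin n) < j := by
          rw [Fin.lt_def]
          have : (j : ℕ) ≠ 0 := fun e => hj (Fin.ext e)
          show 0 < (j : ℕ)
          omega
        have := (h' (el K _ j hlt s)).2
        rw [lie_val] at this
        simp only [el, Derivation.smul_apply] at this
        rw [pderiv_X_of_ne (Ne.symm hjl), smul_zero, map_zero, sub_zero] at this
        exact WW_degree this

/-- For `n ≥ 2` and every natural number `s`, the `s`-th term of the
upper central series of `u_n` (defined by `Z₀ = 0` and `Z_{s+1}` = preimage of the centre
of `u_n/Z_s`, which is Mathlib's `LieSubmodule.ucs s ⊥`) equals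
`⊕_{i=0}^{s-1} K x₁^i ∂ₙ`. -/
theorem triangular_upper_central_series_eq
    (K : Type*) [Field K] [CharZero K] (n : ℕ) (hn : 2 ≤ n) (s : ℕ) :
    (LieSubmodule.ucs s (⊥ : LieIdeal K ↥(triangular K n)) : Set ↥(triangular K n)) =
      (Submodule.span K (mon K n hn '' Set.Iio s) : Set ↥(triangular K n)) := by
  induction s with
  | zero =>
    simp
  | succ s ih =>
    ext D
    rw [LieSubmodule.ucs_succ, SetLike.mem_coe, SetLike.mem_coe, step_mem,
      LieSubmodule.mem_normalizer]
    refine forall_congr' fun E => ?_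
    rw [← SetLike.mem_coe, ih, SetLike.mem_coe]
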